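/- Assume F_ξ⁻¹(z)/T'(z) is nondecreasing in z ∈ (0,1] and liminf_{x→∞}(−x·u''(x)/u'(x)) > 0. Define X(λ) := (u')⁻¹(λ·ξ/T'(F_ξ(ξ))) for λ > 0. If V₁(X(1)) < +∞, then there exists λ > 0 with E[ξ·X(λ)] = a, and for such λ, X(λ) is an optimal solution of Problem (Q). If V₁(X(1)) = +∞, then Problem (Q) is ill-posed, i.e. the supremum of V₁ over its feasible set is +∞. -/

import Mathlib

open MeasureTheory Set Filter
open scoped ENNReal

noncomputable section

/-- Feasibility for the Choquet maximization Problem (Q):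
`X ≥ 0` a.s. with `E[ξX] = a`. -/
def FeasQ {Ω : Type*} [MeasurableSpace Ω] (P : MeasureTheory.Measure Ω)
    (ξ : Ω → ℝ) (a : ℝ) (X : Ω → ℝ) : Prop :=
  AEMeasurable X P ∧ (∀ᵐ ω ∂P, 0 ≤ X ω) ∧
    MeasureTheory.Integrable (fun ω => ξ ω * X ω) P ∧
    (∫ ω, ξ ω * X ω ∂P) = a

/-- The Choquet objective `V₁(X) = ∫₀^∞ T(P{u(X) > y}) dy` of Problem (Q). -/
def Vone {Ω : Type*} [MeasurableSpace Ω] (P : MeasureTheory.Measure Ω)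
    (T u : ℝ → ℝ) (X : Ω → ℝ) : ℝ≥0∞ :=
  ∫⁻ y in Set.Ioi (0:ℝ), ENNReal.ofReal (T ((P {ω | y < u (X ω)}).toReal))

/-- The outcomes at which `ξ` is positive, its distribution function takes a value in `(0, 1)`,
and `F⁻¹ ∘ F` fixes `ξ`. -/
def regularSet {Ω : Type*} (ξ : Ω → ℝ) (F : ℝ → ℝ) : Set Ω :=
  {ω | 0 < ξ ω ∧ F (ξ ω) ∈ Ioo (0 : ℝ) 1 ∧ ∀ y < ξ ω, F y < F (ξ ω)}

theorem sInf_eq_of_mem_regularSet {Ω : Type*} {ξ : Ω → ℝ} {F : ℝ → ℝ} {ω : Ω}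
    (h : ω ∈ regularSet ξ F) :
    sInf {c : EReal | ∃ y : ℝ, 0 ≤ y ∧ F (ξ ω) ≤ F y ∧ c = (y : EReal)} = (ξ ω : EReal) := by
  refine IsLeast.csInf_eq ⟨⟨ξ ω, h.1.le, le_rfl, rfl⟩, ?_⟩
  rintro _ ⟨y, -, hy, rfl⟩
  rw [EReal.coe_le_coe_iff]
  by_contra hc
  exact absurd hy (not_le.2 (h.2.2 y (not_le.1 hc)))

section Uniform

variable {Ω : Type*} [MeasurableSpace Ω] {P : Measure Ω} [IsProbabilityMeasure P]
  {ξ : Ω → ℝ} {F : ℝ → ℝ}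

theorem distribution_mono (hF : ∀ x : ℝ, F x = (P {ω | ξ ω ≤ x}).toReal) : Monotone F := by
  intro x y hxy
  rw [hF, hF]
  exact ENNReal.toReal_mono (measure_ne_top _ _) (measure_mono fun ω h => le_trans h hxy)

theorem distribution_mem_Icc (hF : ∀ x : ℝ, F x = (P {ω | ξ ω ≤ x}).toReal) (x : ℝ) :
    F x ∈ Icc (0 : ℝ) 1 := by
  rw [hF]
  exact ⟨ENNReal.toReal_nonneg, measureReal_le_one⟩

theorem distribution_eq_cdf (hξ : Measurable ξ)
    (hF : ∀ x : ℝ, F x = (P {ω | ξ ω ≤ x}).toReal) : F = ProbabilityTheory.cdf (P.map ξ) := by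
  have := Measure.isProbabilityMeasure_map (μ := P) hξ.aemeasurable
  ext x
  rw [ProbabilityTheory.cdf_eq_real, hF, measureReal_def, Measure.map_apply hξ measurableSet_Iic]
  rfl

theorem distribution_continuous (hξ : Measurable ξ) (hatomless : ∀ b : ℝ, P {ω | ξ ω = b} = 0)
    (hF : ∀ x : ℝ, F x = (P {ω | ξ ω ≤ x}).toReal) : Continuous F := by
  have := Measure.isProbabilityMeasure_map (μ := P) hξ.aemeasurable
  have hmono := distribution_mono hF
  rw [distribution_eq_cdf hξ hF] at hmono ⊢
  refine continuous_iff_continuousAt.2 fun x => ?_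
  rw [hmono.continuousAt_iff_leftLim_eq_rightLim, StieltjesFunction.rightLim_eq]
  have h := (ProbabilityTheory.cdf (P.map ξ)).measure_singleton x
  rw [ProbabilityTheory.measure_cdf, Measure.map_apply hξ (measurableSet_singleton x)] at h
  have h0 : P (ξ ⁻¹' {x}) = 0 := hatomless x
  rw [h0, eq_comm, ENNReal.ofReal_eq_zero] at h
  exact le_antisymm (hmono.leftLim_le le_rfl) (by linarith)

theorem measureReal_distribution_le (hξ : Measurable ξ)
    (hatomless : ∀ b : ℝ, P {ω | ξ ω = b} = 0)
    (hF : ∀ x : ℝ, F x = (P {ω | ξ ω ≤ x}).toReal) {p : ℝ} (hp : p ∈ Icc (0 : ℝ) 1) :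
    P.real {ω | F (ξ ω) ≤ p} = p := by
  have hmono := distribution_mono hF
  have hcont := distribution_continuous hξ hatomless hF
  have hexists : ∀ z ∈ Ioo (0 : ℝ) 1, ∃ c, F c = z := by
    intro z hz
    have hcdf := distribution_eq_cdf hξ hF
    refine mem_range_of_exists_le_of_exists_ge hcont ?_ ?_
    · have := (ProbabilityTheory.tendsto_cdf_atBot (P.map ξ)).eventually (gt_mem_nhds hz.1)
      rw [← hcdf] at this
      exact this.exists.imp fun _ h => h.le
    · have := (ProbabilityTheory.tendsto_cdf_atTop (P.map ξ)).eventually (lt_mem_nhds hz.2)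
      rw [← hcdf] at this
      exact this.exists.imp fun _ h => h.le
  apply le_antisymm
  · rcases hp.2.eq_or_lt with rfl | hp1
    · exact measureReal_le_one
    refine le_of_forall_gt_imp_ge_of_dense fun z hz => ?_
    rcases le_or_gt 1 z with hz1 | hz1
    · exact measureReal_le_one.trans hz1
    obtain ⟨c, rfl⟩ := hexists z ⟨hp.1.trans_lt hz, hz1⟩
    rw [hF c]
    refine measureReal_mono fun ω (h : F (ξ ω) ≤ p) => ?_
    by_contra hc
    have := hmono (le_of_not_ge hc)
    linarith
  · rcases hp.1.eq_or_lt with rfl | hp0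
    · exact measureReal_nonneg
    rcases hp.2.eq_or_lt with rfl | hp1
    · have : {ω | F (ξ ω) ≤ 1} = univ := eq_univ_of_forall fun ω => (distribution_mem_Icc hF _).2
      simp [this]
    obtain ⟨c, rfl⟩ := hexists p ⟨hp0, hp1⟩
    conv_lhs => rw [hF c]
    exact measureReal_mono fun ω (h : ξ ω ≤ c) => hmono h

theorem map_distribution_eq (hξ : Measurable ξ)
    (hatomless : ∀ b : ℝ, P {ω | ξ ω = b} = 0)
    (hF : ∀ x : ℝ, F x = (P {ω | ξ ω ≤ x}).toReal) :
    P.map (fun ω => F (ξ ω)) = volume.restrict (Ioc (0 : ℝ) 1) := by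
  have hm : Measurable fun ω => F (ξ ω) := (distribution_mono hF).measurable.comp hξ
  have := Measure.isProbabilityMeasure_map (μ := P) hm.aemeasurable
  refine Measure.ext_of_Iic _ _ fun p => ?_
  rw [Measure.map_apply hm measurableSet_Iic, Measure.restrict_apply measurableSet_Iic]
  have hI : Iic p ∩ Ioc (0 : ℝ) 1 = Ioc 0 (min p 1) := by
    ext x; simp; tauto
  rw [hI, Real.volume_Ioc, sub_zero]
  rcases lt_or_ge p 0 with h0 | h0
  · rw [ENNReal.ofReal_of_nonpos ((min_le_left _ _).trans h0.le)]
    convert measure_empty (μ := P)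
    refine eq_empty_of_forall_notMem fun ω (h : F (ξ ω) ≤ p) => ?_
    have := (distribution_mem_Icc hF (ξ ω)).1
    linarith
  rcases le_or_gt p 1 with h1 | h1
  · rw [min_eq_left h1, ← measureReal_distribution_le hξ hatomless hF ⟨h0, h1⟩, ofReal_measureReal]
    congr 1
    ext ω
    simp [measureReal_distribution_le hξ hatomless hF ⟨h0, h1⟩]
  · rw [min_eq_right h1.le, ENNReal.ofReal_one]
    convert measure_univ (μ := P)
    exact eq_univ_of_forall fun ω => (distribution_mem_Icc hF _).2.trans h1.le

theorem ae_distribution_ne (hξ : Measurable ξ)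
    (hatomless : ∀ b : ℝ, P {ω | ξ ω = b} = 0)
    (hF : ∀ x : ℝ, F x = (P {ω | ξ ω ≤ x}).toReal) (p : ℝ) :
    ∀ᵐ ω ∂P, F (ξ ω) ≠ p := by
  have hm : Measurable fun ω => F (ξ ω) := (distribution_mono hF).measurable.comp hξ
  refine ae_of_ae_map (p := fun z => z ≠ p) hm.aemeasurable ?_
  rw [map_distribution_eq hξ hatomless hF]
  exact ae_restrict_of_ae (Measure.ae_ne volume p)

theorem ae_mem_regularSet (hξ : Measurable ξ) (hξpos : ∀ᵐ ω ∂P, 0 < ξ ω)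
    (hatomless : ∀ b : ℝ, P {ω | ξ ω = b} = 0)
    (hF : ∀ x : ℝ, F x = (P {ω | ξ ω ≤ x}).toReal) :
    ∀ᵐ ω ∂P, ω ∈ regularSet ξ F := by
  have hne := ae_distribution_ne hξ hatomless hF
  have hmono := distribution_mono hF
  filter_upwards [hξpos, hne 0, hne 1, ae_all_iff.2 fun q : ℚ => hne (F q)] with ω h0 h1 h2 h3
  have h := distribution_mem_Icc hF (ξ ω)
  refine ⟨h0, ⟨h.1.lt_of_ne' h1, h.2.lt_of_ne h2⟩, fun y hy => ?_⟩
  obtain ⟨q, hq, hq'⟩ := exists_rat_btwn hy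
  exact (hmono hq.le).trans_lt ((hmono hq'.le).lt_of_ne (h3 q).symm)

theorem regularSet_le_iff (hF : ∀ x : ℝ, F x = (P {ω | ξ ω ≤ x}).toReal) {ω₁ ω₂ : Ω}
    (h₁ : ω₁ ∈ regularSet ξ F) :
    F (ξ ω₁) ≤ F (ξ ω₂) ↔ ξ ω₁ ≤ ξ ω₂ := by
  refine ⟨fun h => ?_, fun h => distribution_mono hF h⟩
  by_contra hc
  exact absurd h (not_le.2 (h₁.2.2 _ (not_le.1 hc)))

/-- Among the events of probability `p`, the lower event `{F(ξ) ≤ p}` carries the least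
`ξ`-mass. -/
theorem setLIntegral_lower_le (hξ : Measurable ξ) (hξpos : ∀ᵐ ω ∂P, 0 < ξ ω)
    (hatomless : ∀ b : ℝ, P {ω | ξ ω = b} = 0)
    (hF : ∀ x : ℝ, F x = (P {ω | ξ ω ≤ x}).toReal) (A : Set Ω) :
    ∫⁻ ω in {ω | F (ξ ω) ≤ P.real A}, ENNReal.ofReal (ξ ω) ∂P ≤
      ∫⁻ ω in A, ENNReal.ofReal (ξ ω) ∂P := by
  have hmono := distribution_mono hF
  have hpos : 0 ≤ᵐ[P] ξ := hξpos.mono fun ω h => h.le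
  rw [lintegral_eq_lintegral_meas_lt _ (ae_restrict_of_ae hpos) hξ.aemeasurable,
    lintegral_eq_lintegral_meas_lt _ (ae_restrict_of_ae hpos) hξ.aemeasurable]
  refine lintegral_mono fun t => ?_
  have hmt : MeasurableSet {ω | t < ξ ω} := measurableSet_lt measurable_const hξ
  have hle : MeasurableSet {ω | ξ ω ≤ t} := measurableSet_le hξ measurable_const
  rw [Measure.restrict_apply hmt, Measure.restrict_apply hmt,
    ← ENNReal.toReal_le_toReal (measure_ne_top _ _) (measure_ne_top _ _)]
  change P.real _ ≤ P.real _
  have hp : P.real A ∈ Icc (0 : ℝ) 1 := ⟨measureReal_nonneg, measureReal_le_one⟩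
  rcases le_or_gt (F t) (P.real A) with h | h
  · have h1 : P.real ({ω | t < ξ ω} ∩ {ω | F (ξ ω) ≤ P.real A}) + F t = P.real A := by
      conv_rhs => rw [← measureReal_distribution_le hξ hatomless hF hp]
      rw [hF t, ← measureReal_def, ← measureReal_union ?_ hle]
      · congr 1
        ext ω
        simp only [mem_union, mem_inter_iff, mem_ofPred_eq]
        rcases lt_or_ge t (ξ ω) with h' | h'
        · simp [h', not_le.2 h']
        · simp [h', (hmono h').trans h]
      · exact disjoint_left.2 fun ω h1 (h2 : ξ ω ≤ t) => h2.not_gt h1.1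
    have h2 : P.real A ≤ P.real ({ω | t < ξ ω} ∩ A) + F t := by
      rw [hF t, ← measureReal_def]
      refine (measureReal_mono fun ω hω => ?_).trans (measureReal_union_le _ _)
      rcases lt_or_ge t (ξ ω) with h' | h'
      · exact Or.inl ⟨h', hω⟩
      · exact Or.inr h'
    linarith
  · have : {ω | t < ξ ω} ∩ {ω | F (ξ ω) ≤ P.real A} = ∅ := by
      refine eq_empty_of_forall_notMem fun ω ⟨h1, h2⟩ => ?_
      have := hmono h1.le
      simp only [mem_ofPred_eq] at h2
      linarith
    rw [this]
    simp

/-- A null-measurable event that is lower with respect to `ξ` is a.s. an event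
`{F(ξ) ≤ p}`. -/
theorem ae_eq_lower (hξ : Measurable ξ) (hξpos : ∀ᵐ ω ∂P, 0 < ξ ω)
    (hatomless : ∀ b : ℝ, P {ω | ξ ω = b} = 0)
    (hF : ∀ x : ℝ, F x = (P {ω | ξ ω ≤ x}).toReal) {B : Set Ω} (hB : NullMeasurableSet B P)
    (hlower : ∀ ω₁ ∈ regularSet ξ F, ∀ ω₂ ∈ regularSet ξ F, ξ ω₁ ≤ ξ ω₂ → ω₂ ∈ B → ω₁ ∈ B) :
    B =ᵐ[P] {ω | F (ξ ω) ≤ P.real B} := by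
  have hm : Measurable fun ω => F (ξ ω) := (distribution_mono hF).measurable.comp hξ
  have hreg := ae_mem_regularSet hξ hξpos hatomless hF
  have hp : P.real B ∈ Icc (0 : ℝ) 1 := ⟨measureReal_nonneg, measureReal_le_one⟩
  have hmeas : P {ω | F (ξ ω) ≤ P.real B} = P B :=
    (ENNReal.toReal_eq_toReal_iff' (measure_ne_top _ _) (measure_ne_top _ _)).1
      (measureReal_distribution_le hξ hatomless hF hp)
  by_cases h : ∃ ω₂ ∈ regularSet ξ F, ω₂ ∈ B ∧ P.real B < F (ξ ω₂)
  · obtain ⟨ω₂, h₂, hB₂, hlt⟩ := h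
    refine (ae_eq_of_ae_subset_of_measure_ge ?_ hmeas.ge
      (measurableSet_le hm measurable_const).nullMeasurableSet (measure_ne_top _ _)).symm
    filter_upwards [hreg] with ω hω (hle : F (ξ ω) ≤ P.real B)
    exact hlower ω hω ω₂ h₂ ((regularSet_le_iff hF hω).1 (hle.trans hlt.le)) hB₂
  · push Not at h
    refine ae_eq_of_ae_subset_of_measure_ge ?_ hmeas.le hB (measure_ne_top _ _)
    filter_upwards [hreg] with ω hω hωB
    exact h ω hω hωB

end Uniform

section Distortion

variable {T T' : ℝ → ℝ}

theorem distortion_deriv_nonneg (hTmono : StrictMonoOn T (Icc 0 1))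
    (hT' : ∀ x ∈ Icc (0 : ℝ) 1, HasDerivWithinAt T (T' x) (Icc 0 1) x) {x : ℝ}
    (hx : x ∈ Icc (0 : ℝ) 1) : 0 ≤ T' x := by
  rw [← (hT' x hx).derivWithin (uniqueDiffOn_Icc zero_lt_one x hx)]
  exact hTmono.monotoneOn.derivWithin_nonneg

theorem distortion_continuousOn
    (hT' : ∀ x ∈ Icc (0 : ℝ) 1, HasDerivWithinAt T (T' x) (Icc 0 1) x) :
    ContinuousOn T (Icc 0 1) := fun x hx => (hT' x hx).continuousWithinAt

theorem distortion_hasDerivAt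
    (hT' : ∀ x ∈ Icc (0 : ℝ) 1, HasDerivWithinAt T (T' x) (Icc 0 1) x) {x : ℝ}
    (hx : x ∈ Ioo (0 : ℝ) 1) : HasDerivAt T (T' x) x :=
  (hT' x (Ioo_subset_Icc_self hx)).hasDerivAt (Icc_mem_nhds hx.1 hx.2)

theorem distortion_deriv_integrableOn (hTmono : StrictMonoOn T (Icc 0 1))
    (hT' : ∀ x ∈ Icc (0 : ℝ) 1, HasDerivWithinAt T (T' x) (Icc 0 1) x) :
    IntegrableOn T' (Ioc 0 1) :=
  intervalIntegral.integrableOn_deriv_of_nonneg (distortion_continuousOn hT')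
    (fun _ hx => distortion_hasDerivAt hT' hx)
    fun _ hx => distortion_deriv_nonneg hTmono hT' (Ioo_subset_Icc_self hx)

theorem setLIntegral_distortion_deriv (hTmono : StrictMonoOn T (Icc 0 1))
    (hT' : ∀ x ∈ Icc (0 : ℝ) 1, HasDerivWithinAt T (T' x) (Icc 0 1) x) (hT0 : T 0 = 0)
    {p : ℝ} (hp : p ∈ Icc (0 : ℝ) 1) :
    ∫⁻ z in Ioc 0 p, ENNReal.ofReal (T' z) = ENNReal.ofReal (T p) := by
  have hintegrable : IntegrableOn T' (Ioc 0 p) :=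
    (distortion_deriv_integrableOn hTmono hT').mono_set (Ioc_subset_Ioc_right hp.2)
  rw [← ofReal_integral_eq_lintegral_ofReal hintegrable, ← intervalIntegral.integral_of_le hp.1,
    intervalIntegral.integral_eq_sub_of_hasDerivAt_of_le hp.1
      ((distortion_continuousOn hT').mono (Icc_subset_Icc_right hp.2))
      (fun x hx => distortion_hasDerivAt hT' ⟨hx.1, hx.2.trans_le hp.2⟩)
      ((intervalIntegrable_iff_integrableOn_Ioc_of_le hp.1).2 hintegrable), hT0, sub_zero]
  refine (ae_restrict_iff' measurableSet_Ioc).2 (ae_of_all _ fun x hx => ?_)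
  exact distortion_deriv_nonneg hTmono hT' ⟨hx.1.le, hx.2.trans hp.2⟩

end Distortion

/-- `w` is a density (on a set `G` of full measure) that represents the distortion `T` on events
that are lower with respect to `ξ`, has `ξ / w` nondecreasing in `ξ`, and is such that every event
can be exchanged for an equally likely one with `w`-mass given by `T` and smaller `ξ`-mass. -/
structure IsDistortionDensity {Ω : Type*} [MeasurableSpace Ω] (P : Measure Ω) (ξ : Ω → ℝ)
    (T : ℝ → ℝ) (w : Ω → ℝ) (G : Set Ω) : Prop where
  measurable_price : Measurable ξ
  aemeasurable : AEMeasurable w P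
  ae_mem : ∀ᵐ ω ∂P, ω ∈ G
  price_pos : ∀ ω ∈ G, 0 < ξ ω
  pos : ∀ ω ∈ G, 0 < w ω
  ratio_mono : ∀ ω₁ ∈ G, ∀ ω₂ ∈ G, ξ ω₁ ≤ ξ ω₂ → ξ ω₁ / w ω₁ ≤ ξ ω₂ / w ω₂
  lintegral_lower : ∀ B : Set Ω, NullMeasurableSet B P →
    (∀ ω₁ ∈ G, ∀ ω₂ ∈ G, ξ ω₁ ≤ ξ ω₂ → ω₂ ∈ B → ω₁ ∈ B) →
    ∫⁻ ω in B, ENNReal.ofReal (w ω) ∂P = ENNReal.ofReal (T (P B).toReal)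
  exists_cheaper : ∀ A : Set Ω, ∃ A' : Set Ω, NullMeasurableSet A' P ∧
    ∫⁻ ω in A', ENNReal.ofReal (w ω) ∂P = ENNReal.ofReal (T (P A).toReal) ∧
    ∫⁻ ω in A', ENNReal.ofReal (ξ ω) ∂P ≤ ∫⁻ ω in A, ENNReal.ofReal (ξ ω) ∂P

theorem isDistortionDensity_deriv {Ω : Type*} [MeasurableSpace Ω] {P : Measure Ω}
    [IsProbabilityMeasure P] {ξ : Ω → ℝ} {F T T' : ℝ → ℝ}
    (hξ : Measurable ξ) (hξpos : ∀ᵐ ω ∂P, 0 < ξ ω)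
    (hatomless : ∀ b : ℝ, P {ω | ξ ω = b} = 0)
    (hF : ∀ x : ℝ, F x = (P {ω | ξ ω ≤ x}).toReal)
    (hTmono : StrictMonoOn T (Icc 0 1))
    (hT' : ∀ x ∈ Icc (0 : ℝ) 1, HasDerivWithinAt T (T' x) (Icc 0 1) x) (hT0 : T 0 = 0)
    (hFdec : ∀ z₁ z₂ : ℝ, 0 < z₁ → z₁ ≤ z₂ → z₂ ≤ 1 →
      sInf {c : EReal | ∃ y : ℝ, 0 ≤ y ∧ z₁ ≤ F y ∧ c = (y : EReal)} * ((T' z₂ : ℝ) : EReal) ≤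
        sInf {c : EReal | ∃ y : ℝ, 0 ≤ y ∧ z₂ ≤ F y ∧ c = (y : EReal)} * ((T' z₁ : ℝ) : EReal)) :
    IsDistortionDensity P ξ T (fun ω => T' (F (ξ ω))) (regularSet ξ F) := by
  have hm : Measurable fun ω => F (ξ ω) := (distribution_mono hF).measurable.comp hξ
  have hintegrable := distortion_deriv_integrableOn hTmono hT'
  have hmap := map_distribution_eq hξ hatomless hF
  have hwm : AEMeasurable (fun ω => T' (F (ξ ω))) P := by
    refine AEMeasurable.comp_aemeasurable (g := T') ?_ hm.aemeasurable
    rw [hmap]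
    exact hintegrable.aestronglyMeasurable.aemeasurable
  have hlow : ∀ p ∈ Icc (0 : ℝ) 1,
      ∫⁻ ω in {ω | F (ξ ω) ≤ p}, ENNReal.ofReal (T' (F (ξ ω))) ∂P = ENNReal.ofReal (T p) := by
    intro p hp
    have hres : (P.restrict {ω | F (ξ ω) ≤ p}).map (fun ω => F (ξ ω)) =
        volume.restrict (Ioc (0 : ℝ) p) := by
      have := Measure.restrict_map (μ := P) hm (measurableSet_Iic (a := p))
      rw [hmap, Measure.restrict_restrict measurableSet_Iic] at this
      refine this.symm.trans ?_
      congr 1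
      ext x
      simp only [mem_inter_iff, mem_Iic, mem_Ioc]
      exact ⟨fun h => ⟨h.2.1, h.1⟩, fun h => ⟨h.2, h.1, h.2.trans hp.2⟩⟩
    rw [← setLIntegral_distortion_deriv hTmono hT' hT0 hp, ← hres,
      lintegral_map' (f := fun z => ENNReal.ofReal (T' z)) ?_ hm.aemeasurable]
    rw [hres]
    exact (hintegrable.mono_set (Ioc_subset_Ioc_right hp.2)).aestronglyMeasurable.aemeasurable.ennreal_ofReal
  have hpos : ∀ ω ∈ regularSet ξ F, 0 < T' (F (ξ ω)) := by
    intro ω hω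
    have hz := hω.2.1
    refine (distortion_deriv_nonneg hTmono hT' (Ioo_subset_Icc_self hz)).lt_of_ne' fun h0 => ?_
    obtain ⟨z, hz', hslope⟩ := exists_hasDerivAt_eq_slope T T' hz.2
      ((distortion_continuousOn hT').mono (Icc_subset_Icc_left hz.1.le))
      fun x hx => distortion_hasDerivAt hT' ⟨hz.1.trans hx.1, hx.2⟩
    have hpos : 0 < T' z := by
      rw [hslope]
      exact div_pos (sub_pos.2 (hTmono (Ioo_subset_Icc_self hz) (right_mem_Icc.2 zero_le_one) hz.2))
        (sub_pos.2 hz.2)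
    have h := hFdec (F (ξ ω)) z hz.1 hz'.1.le hz'.2.le
    rw [sInf_eq_of_mem_regularSet hω, h0, EReal.coe_zero, mul_zero, ← EReal.coe_mul,
      ← EReal.coe_zero, EReal.coe_le_coe_iff] at h
    exact absurd h (not_le.2 (mul_pos hω.1 hpos))
  have hprob : ∀ A : Set Ω, P.real A ∈ Icc (0 : ℝ) 1 :=
    fun A => ⟨measureReal_nonneg, measureReal_le_one⟩
  refine ⟨hξ, hwm, ae_mem_regularSet hξ hξpos hatomless hF, fun ω h => h.1, hpos, ?_, ?_, ?_⟩
  · intro ω₁ h₁ ω₂ h₂ h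
    have hz := (regularSet_le_iff hF h₁).2 h
    have := hFdec _ _ h₁.2.1.1 hz h₂.2.1.2.le
    rw [sInf_eq_of_mem_regularSet h₁, sInf_eq_of_mem_regularSet h₂, ← EReal.coe_mul,
      ← EReal.coe_mul, EReal.coe_le_coe_iff] at this
    rwa [div_le_div_iff₀ (hpos _ h₁) (hpos _ h₂)]
  · intro B hB hlower
    rw [setLIntegral_congr (ae_eq_lower hξ hξpos hatomless hF hB hlower), hlow _ (hprob B)]
    rfl
  · exact fun A => ⟨_, (measurableSet_le hm measurable_const).nullMeasurableSet, hlow _ (hprob A),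
      setLIntegral_lower_le hξ hξpos hatomless hF A⟩

/-- `u` is increasing and concave on `[0, ∞)` with `u 0 = 0`, its derivative `u'` on `(0, ∞)` is
positive and strictly decreasing, and `I` inverts `u'`. -/
structure IsUtility (u u' I : ℝ → ℝ) : Prop where
  strictMonoOn : StrictMonoOn u (Ici 0)
  concaveOn : ConcaveOn ℝ (Ici 0) u
  map_zero : u 0 = 0
  hasDerivAt : ∀ x ∈ Ioi (0 : ℝ), HasDerivAt u (u' x) x
  deriv_pos : ∀ x ∈ Ioi (0 : ℝ), 0 < u' x
  deriv_strictAntiOn : StrictAntiOn u' (Ioi 0)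
  inverse_pos : ∀ y : ℝ, 0 < y → 0 < I y
  deriv_inverse : ∀ y : ℝ, 0 < y → u' (I y) = y

namespace IsUtility

variable {u u' I : ℝ → ℝ}

theorem of_strictConcaveOn (humono : StrictMonoOn u (Ici 0))
    (huconc : StrictConcaveOn ℝ (Ici 0) u) (hu0 : u 0 = 0)
    (hu' : ∀ x ∈ Ioi (0 : ℝ), HasDerivAt u (u' x) x)
    (hI : ∀ y : ℝ, 0 < y → 0 < I y ∧ u' (I y) = y) : IsUtility u u' I where
  strictMonoOn := humono
  concaveOn := huconc.concaveOn
  map_zero := hu0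
  hasDerivAt := hu'
  deriv_pos x hx := by
    have hx1 : x < x + 1 := by linarith
    have hx' : (0 : ℝ) ≤ x := le_of_lt hx
    have h := huconc.concaveOn.slope_le_of_hasDerivAt (mem_Ici.2 hx')
      (mem_Ici.2 (hx'.trans hx1.le)) hx1 (hu' x hx)
    refine lt_of_lt_of_le ?_ h
    rw [slope_def_field]
    have := humono (mem_Ici.2 hx') (mem_Ici.2 (hx'.trans hx1.le)) hx1
    exact div_pos (by linarith) (by linarith)
  deriv_strictAntiOn := by
    have h := (huconc.subset Ioi_subset_Ici_self (convex_Ioi 0)).strictAntiOn_deriv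
      fun x hx => (hu' x hx).differentiableAt
    intro x hx y hy hxy
    rw [← (hu' x hx).deriv, ← (hu' y hy).deriv]
    exact h hx hy hxy
  inverse_pos y hy := (hI y hy).1
  deriv_inverse y hy := (hI y hy).2

variable (h : IsUtility u u' I)
include h

theorem lt_inverse_iff {x y : ℝ} (hx : 0 < x) (hy : 0 < y) : x < I y ↔ y < u' x := by
  rw [← h.deriv_strictAntiOn.lt_iff_gt (h.inverse_pos y hy) hx, h.deriv_inverse y hy]

theorem inverse_lt_iff {x y : ℝ} (hx : 0 < x) (hy : 0 < y) : I y < x ↔ u' x < y := by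
  rw [← h.deriv_strictAntiOn.lt_iff_gt hx (h.inverse_pos y hy), h.deriv_inverse y hy]

theorem inverse_antitoneOn : AntitoneOn I (Ioi 0) := by
  intro y hy z hz hyz
  by_contra hc
  have := (h.lt_inverse_iff (h.inverse_pos y hy) hz).1 (not_le.1 hc)
  rw [h.deriv_inverse y hy] at this
  exact absurd hyz (not_le.2 this)

theorem inverse_continuousOn : ContinuousOn I (Ioi 0) := by
  intro y hy
  refine tendsto_order.2 ⟨fun b hb => ?_, fun b hb => ?_⟩
  · rcases le_or_gt b 0 with hb0 | hb0
    · filter_upwards [self_mem_nhdsWithin] with z hz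
      exact hb0.trans_lt (h.inverse_pos z hz)
    · filter_upwards [self_mem_nhdsWithin,
        mem_nhdsWithin_of_mem_nhds (gt_mem_nhds ((h.lt_inverse_iff hb0 hy).1 hb))] with z hz hzb
      exact (h.lt_inverse_iff hb0 hz).2 hzb
  · have hb0 : 0 < b := (h.inverse_pos y hy).trans hb
    filter_upwards [self_mem_nhdsWithin,
      mem_nhdsWithin_of_mem_nhds (lt_mem_nhds ((h.inverse_lt_iff hb0 hy).1 hb))] with z hz hzb
    exact (h.inverse_lt_iff hb0 hz).2 hzb

theorem tendsto_inverse_atTop : Tendsto I atTop (nhds 0) := by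
  refine tendsto_order.2 ⟨fun b hb => ?_, fun b hb => ?_⟩
  · filter_upwards [eventually_gt_atTop 0] with z hz
    exact hb.trans (h.inverse_pos z hz)
  · filter_upwards [eventually_gt_atTop 0, eventually_gt_atTop (u' b)] with z hz hzb
    exact (h.inverse_lt_iff hb hz).2 hzb

theorem tendsto_inverse_zero : Tendsto I (nhdsWithin 0 (Ioi 0)) atTop := by
  refine tendsto_atTop.2 fun b => ?_
  have hb : (0 : ℝ) < max b 1 := lt_max_of_lt_right one_pos
  filter_upwards [self_mem_nhdsWithin,
    mem_nhdsWithin_of_mem_nhds (gt_mem_nhds (h.deriv_pos _ hb))] with z hz hzb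
  exact (le_max_left b 1).trans ((h.lt_inverse_iff hb hz).2 hzb).le

theorem nonneg {x : ℝ} (hx : 0 ≤ x) : 0 ≤ u x := by
  rw [← h.map_zero]
  exact h.strictMonoOn.monotoneOn self_mem_Ici hx hx

theorem mul_deriv_le {x : ℝ} (hx : 0 < x) : x * u' x ≤ u x := by
  have := h.concaveOn.le_slope_of_hasDerivAt self_mem_Ici (mem_Ici.2 hx.le) hx (h.hasDerivAt x hx)
  rw [slope_def_field, h.map_zero, sub_zero, sub_zero, le_div_iff₀ hx] at this
  linarith

theorem mul_le_map_mul {t x : ℝ} (ht : 0 ≤ t) (ht1 : t ≤ 1) (hx : 0 ≤ x) :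
    t * u x ≤ u (t * x) := by
  have := h.concaveOn.2 (mem_Ici.2 hx) self_mem_Ici ht (sub_nonneg.2 ht1) (by ring)
  simpa [h.map_zero] using this

theorem map_mul_le {k x : ℝ} (hk : 1 ≤ k) (hx : 0 ≤ x) : u (k * x) ≤ k * u x := by
  have hk0 : 0 < k := one_pos.trans_le hk
  have := h.mul_le_map_mul (t := k⁻¹) (x := k * x) (inv_nonneg.2 hk0.le) (inv_le_one_of_one_le₀ hk)
    (mul_nonneg hk0.le hx)
  rw [inv_mul_cancel_left₀ hk0.ne', inv_mul_le_iff₀ hk0] at this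
  exact this

/-- If the relative risk aversion of `u` is bounded below near infinity by a positive constant,
then a rescaling of marginal utility changes the utility level by at most an affine map. -/
theorem exists_map_inverse_mul_le {u'' : ℝ → ℝ}
    (hu'' : ∀ x ∈ Ioi (0 : ℝ), HasDerivAt u' (u'' x) x)
    (hliminf : 0 < liminf (fun x : ℝ => -x * u'' x / u' x) atTop) {r : ℝ} (hr : 0 < r) :
    ∃ k C : ℝ, 0 ≤ k ∧ 0 ≤ C ∧ ∀ y : ℝ, 0 < y → u (I (r * y)) ≤ k * u (I y) + C := by
  have humono := h.strictMonoOn.monotoneOn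
  rcases le_or_gt 1 r with hr1 | hr1
  · refine ⟨1, 0, zero_le_one, le_rfl, fun y hy => ?_⟩
    rw [one_mul, add_zero]
    have hry := mul_pos hr hy
    exact humono (h.inverse_pos _ hry).le (h.inverse_pos _ hy).le
      (h.inverse_antitoneOn hy hry (le_mul_of_one_le_left hy.le hr1))
  obtain ⟨c, hc, hc0⟩ : ∃ c, (∀ᶠ x : ℝ in atTop, c ≤ -x * u'' x / u' x) ∧ 0 < c := by
    rw [liminf_eq] at hliminf
    rcases eq_empty_or_nonempty {c | ∀ᶠ x : ℝ in atTop, c ≤ -x * u'' x / u' x} with hne | hne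
    · rw [hne, Real.sSup_empty] at hliminf
      exact absurd hliminf (lt_irrefl _)
    · exact exists_lt_of_lt_csSup hne hliminf
  obtain ⟨b, hb⟩ := eventually_atTop.1 hc
  have hx₀ : (0 : ℝ) < max b 1 := lt_max_of_lt_right one_pos
  replace hb : ∀ x, max b 1 ≤ x → c ≤ -x * u'' x / u' x :=
    fun x hx => hb x ((le_max_left _ _).trans hx)
  generalize max b 1 = x₀ at hx₀ hb
  have hderiv : ∀ x, x₀ ≤ x →
      HasDerivAt (fun x => x ^ c * u' x) (c * x ^ (c - 1) * u' x + x ^ c * u'' x) x := by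
    intro x hx
    have hxpos := hx₀.trans_le hx
    exact (Real.hasDerivAt_rpow_const (Or.inl hxpos.ne')).mul (hu'' x hxpos)
  have hanti : AntitoneOn (fun x => x ^ c * u' x) (Ici x₀) := by
    refine antitoneOn_of_deriv_nonpos (convex_Ici _)
      (fun x hx => (hderiv x hx).continuousAt.continuousWithinAt)
      (fun x hx => (hderiv x (interior_subset hx)).differentiableAt.differentiableWithinAt)
      fun x hx => ?_
    replace hx : x₀ ≤ x := interior_subset hx
    have hxpos := hx₀.trans_le hx
    rw [(hderiv x hx).deriv]
    have h1 := hb x hx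
    rw [le_div_iff₀ (h.deriv_pos x hxpos)] at h1
    have h2 : x ^ c = x ^ (c - 1) * x := by
      rw [← Real.rpow_add_one hxpos.ne', sub_add_cancel]
    rw [h2]
    have h3 : 0 < x ^ (c - 1) := Real.rpow_pos_of_pos hxpos _
    nlinarith
  have hk1 : 1 ≤ r ^ (-c⁻¹) :=
    Real.one_le_rpow_of_pos_of_le_one_of_nonpos hr hr1.le (by simpa using hc0.le)
  have hkc : (r ^ (-c⁻¹)) ^ c = r⁻¹ := by
    rw [← Real.rpow_mul hr.le, neg_mul, inv_mul_cancel₀ hc0.ne', Real.rpow_neg_one]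
  generalize r ^ (-c⁻¹) = k at hk1 hkc
  have hk0 : 0 < k := one_pos.trans_le hk1
  have hC : 0 < r * u' x₀ := mul_pos hr (h.deriv_pos _ hx₀)
  refine ⟨k, u (I (r * u' x₀)), hk0.le, h.nonneg (h.inverse_pos _ hC).le, fun y hy => ?_⟩
  have hry := mul_pos hr hy
  have hIy := h.inverse_pos y hy
  rcases le_or_gt x₀ (I y) with hx | hx
  · have hkx : I y ≤ k * I y := le_mul_of_one_le_left hIy.le hk1
    have h1 := hanti (mem_Ici.2 hx) (mem_Ici.2 (hx.trans hkx)) hkx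
    simp only [Real.mul_rpow hk0.le hIy.le, hkc, h.deriv_inverse y hy] at h1
    have h2 : 0 < I y ^ c := Real.rpow_pos_of_pos hIy _
    have h3 : u' (k * I y) ≤ r * y := by
      rw [← inv_mul_le_iff₀ hr]
      refine le_of_mul_le_mul_left ?_ h2
      linarith
    have h4 : I (r * y) ≤ k * I y := by
      by_contra hcon
      exact absurd h3 (not_le.2 ((h.lt_inverse_iff (mul_pos hk0 hIy) hry).1 (not_le.1 hcon)))
    have h5 := humono (h.inverse_pos _ hry).le (mul_pos hk0 hIy).le h4
    have h6 := h.map_mul_le hk1 hIy.le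
    have h7 := h.nonneg (h.inverse_pos _ hC).le
    linarith
  · have h1 : u' x₀ ≤ y := ((h.inverse_lt_iff hx₀ hy).1 hx).le
    have h2 := h.inverse_antitoneOn hC hry (mul_le_mul_of_nonneg_left h1 hr.le)
    have h3 := humono (h.inverse_pos _ hry).le (h.inverse_pos _ hC).le h2
    have h4 := mul_nonneg hk0.le (h.nonneg hIy.le)
    linarith

end IsUtility

section Payoff

variable {Ω : Type*} [MeasurableSpace Ω] {P : Measure Ω}

theorem IsUtility.aemeasurable_comp {u u' I : ℝ → ℝ} (h : IsUtility u u' I) {Y : Ω → ℝ}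
    (hY : AEMeasurable Y P) (hY0 : ∀ᵐ ω ∂P, 0 ≤ Y ω) : AEMeasurable (fun ω => u (Y ω)) P := by
  have hm : Monotone fun x => u (max x 0) := fun x y hxy =>
    h.strictMonoOn.monotoneOn (le_max_right x 0) (le_max_right y 0) (max_le_max_right 0 hxy)
  refine (hm.measurable.comp_aemeasurable hY).congr ?_
  filter_upwards [hY0] with ω hω
  simp [hω]

/-- Layer-cake formula for a measure with density `g`. -/
theorem lintegral_setLIntegral_superlevel [SFinite P] {g X : Ω → ℝ} (hg : AEMeasurable g P)
    (hg0 : ∀ᵐ ω ∂P, 0 ≤ g ω) (hX : AEMeasurable X P) (hX0 : ∀ᵐ ω ∂P, 0 ≤ X ω) :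
    ∫⁻ x in Ioi (0 : ℝ), ∫⁻ ω in {ω | x < X ω}, ENNReal.ofReal (g ω) ∂P =
      ∫⁻ ω, ENNReal.ofReal (g ω * X ω) ∂P := by
  have hac := withDensity_absolutelyContinuous P fun ω => ENNReal.ofReal (g ω)
  have := lintegral_eq_lintegral_meas_lt (P.withDensity fun ω => ENNReal.ofReal (g ω))
    (hac.ae_le hX0) (hX.mono_ac hac)
  simp_rw [withDensity_apply'] at this
  rw [← this, lintegral_withDensity_eq_lintegral_mul₀ hg.ennreal_ofReal hX.ennreal_ofReal]
  refine lintegral_congr_ae ?_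
  filter_upwards [hg0] with ω hω
  rw [Pi.mul_apply, ENNReal.ofReal_mul hω]

/-- The candidate payoff `(u')⁻¹(l ξ / w)`, where `I = (u')⁻¹`. -/
def candidatePayoff (I : ℝ → ℝ) (ξ w : Ω → ℝ) (l : ℝ) : Ω → ℝ :=
  fun ω => I (l * ξ ω / w ω)

namespace IsDistortionDensity

variable {ξ w : Ω → ℝ} {T : ℝ → ℝ} {G : Set Ω} {u u' I : ℝ → ℝ} {l : ℝ}
  (d : IsDistortionDensity P ξ T w G)
include d

theorem price_nonneg_ae : ∀ᵐ ω ∂P, 0 ≤ ξ ω :=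
  d.ae_mem.mono fun ω hω => (d.price_pos ω hω).le

theorem nonneg_ae : ∀ᵐ ω ∂P, 0 ≤ w ω :=
  d.ae_mem.mono fun ω hω => (d.pos ω hω).le

theorem ofReal_map_zero : ENNReal.ofReal (T 0) = 0 := by
  simpa using (d.lintegral_lower ∅ nullMeasurableSet_empty fun _ _ _ _ _ h => h).symm

theorem ratio_pos (hl : 0 < l) {ω : Ω} (hω : ω ∈ G) : 0 < l * ξ ω / w ω :=
  div_pos (mul_pos hl (d.price_pos ω hω)) (d.pos ω hω)

theorem candidatePayoff_pos (h : IsUtility u u' I) (hl : 0 < l) {ω : Ω} (hω : ω ∈ G) :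
    0 < candidatePayoff I ξ w l ω :=
  h.inverse_pos _ (d.ratio_pos hl hω)

theorem candidatePayoff_antitone (h : IsUtility u u' I) (hl : 0 < l) :
    ∀ ω₁ ∈ G, ∀ ω₂ ∈ G, ξ ω₁ ≤ ξ ω₂ →
      candidatePayoff I ξ w l ω₂ ≤ candidatePayoff I ξ w l ω₁ := by
  intro ω₁ h₁ ω₂ h₂ hle
  refine h.inverse_antitoneOn (d.ratio_pos hl h₁) (d.ratio_pos hl h₂) ?_
  rw [mul_div_assoc, mul_div_assoc]
  exact mul_le_mul_of_nonneg_left (d.ratio_mono ω₁ h₁ ω₂ h₂ hle) hl.le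

theorem candidatePayoff_aemeasurable (h : IsUtility u u' I) (hl : 0 < l) :
    AEMeasurable (candidatePayoff I ξ w l) P := by
  classical
  have hJ : Measurable ((Ioi (0 : ℝ)).piecewise I 0) :=
    h.inverse_continuousOn.measurable_piecewise continuousOn_const measurableSet_Ioi
  refine (hJ.comp_aemeasurable
    ((d.measurable_price.const_mul l).aemeasurable.div d.aemeasurable)).congr ?_
  filter_upwards [d.ae_mem] with ω hω
  exact piecewise_eq_of_mem _ _ _ (d.ratio_pos hl hω)

/-- At each wealth level, the superlevel set of the candidate payoff maximizes the Lagrangian. -/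
theorem lagrangian_le (h : IsUtility u u' I) (hl : 0 < l) {x : ℝ} (hx : 0 < x) (A : Set Ω) :
    ENNReal.ofReal (u' x) * ENNReal.ofReal (T (P A).toReal) +
        ENNReal.ofReal l * ∫⁻ ω in {ω | x < candidatePayoff I ξ w l ω}, ENNReal.ofReal (ξ ω) ∂P ≤
      ENNReal.ofReal (u' x) *
          ENNReal.ofReal (T (P {ω | x < candidatePayoff I ξ w l ω}).toReal) +
        ENNReal.ofReal l * ∫⁻ ω in A, ENNReal.ofReal (ξ ω) ∂P := by
  obtain ⟨A', hmA, hTA, hcost⟩ := d.exists_cheaper A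
  have hmB : NullMeasurableSet {ω | x < candidatePayoff I ξ w l ω} P :=
    nullMeasurableSet_lt aemeasurable_const (d.candidatePayoff_aemeasurable h hl)
  refine le_trans ?_ (add_le_add_right (mul_le_mul_right hcost _) _)
  rw [← hTA, ← d.lintegral_lower _ hmB fun ω₁ h₁ ω₂ h₂ hle hy =>
    lt_of_lt_of_le hy (d.candidatePayoff_antitone h hl ω₁ h₁ ω₂ h₂ hle)]
  have hwm := d.aemeasurable.ennreal_ofReal
  simp only [← lintegral_const_mul' _ _ ENNReal.ofReal_ne_top]
  rw [← lintegral_indicator₀ hmA, ← lintegral_indicator₀ hmA, ← lintegral_indicator₀ hmB,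
    ← lintegral_indicator₀ hmB, ← lintegral_add_left' ((hwm.const_mul _).indicator₀ hmA),
    ← lintegral_add_left' ((hwm.const_mul _).indicator₀ hmB)]
  refine lintegral_mono_ae ?_
  filter_upwards [d.ae_mem] with ω hω
  have hw := d.pos ω hω
  have hu := h.deriv_pos x hx
  have hiff : x < candidatePayoff I ξ w l ω ↔ l * ξ ω < u' x * w ω := by
    rw [← div_lt_iff₀ hw]
    exact h.lt_inverse_iff hx (d.ratio_pos hl hω)
  by_cases hA : ω ∈ A' <;> by_cases hB : x < candidatePayoff I ξ w l ω <;>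
    simp only [indicator, mem_ofPred_eq, hA, hB, if_true, if_false, zero_add, add_zero, le_refl]
  all_goals rw [← ENNReal.ofReal_mul hu.le, ← ENNReal.ofReal_mul hl.le]
  · exact ENNReal.ofReal_le_ofReal (not_lt.1 fun hc => hB (hiff.2 hc))
  · exact ENNReal.ofReal_le_ofReal (hiff.1 hB).le

variable [IsProbabilityMeasure P]

theorem lintegral_eq : ∫⁻ ω, ENNReal.ofReal (w ω) ∂P = ENNReal.ofReal (T 1) := by
  simpa using d.lintegral_lower univ nullMeasurableSet_univ fun _ _ _ _ _ _ => mem_univ _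

theorem ofReal_map_le (A : Set Ω) :
    ENNReal.ofReal (T (P A).toReal) ≤ ENNReal.ofReal (T (P univ).toReal) := by
  obtain ⟨A', -, hA', -⟩ := d.exists_cheaper A
  rw [← hA', measure_univ, ENNReal.toReal_one, ← d.lintegral_eq]
  exact setLIntegral_le_lintegral _ _

/-- For payoffs that are nonincreasing in `ξ`, the Choquet objective is a linear functional of
utility. -/
theorem vone_eq (h : IsUtility u u' I) {Y : Ω → ℝ} (hY : AEMeasurable Y P)
    (hY0 : ∀ ω ∈ G, 0 ≤ Y ω)
    (hanti : ∀ ω₁ ∈ G, ∀ ω₂ ∈ G, ξ ω₁ ≤ ξ ω₂ → Y ω₂ ≤ Y ω₁) :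
    Vone P T u Y = ∫⁻ ω, ENNReal.ofReal (w ω * u (Y ω)) ∂P := by
  have hY0' : ∀ᵐ ω ∂P, 0 ≤ Y ω := d.ae_mem.mono hY0
  have hm := h.aemeasurable_comp hY hY0'
  rw [← lintegral_setLIntegral_superlevel d.aemeasurable d.nonneg_ae hm
    (hY0'.mono fun ω hω => h.nonneg hω)]
  refine lintegral_congr fun y => (d.lintegral_lower _ (nullMeasurableSet_lt aemeasurable_const hm)
    fun ω₁ h₁ ω₂ h₂ hle hy => ?_).symm
  exact lt_of_lt_of_le hy
    (h.strictMonoOn.monotoneOn (hY0 ω₂ h₂) (hY0 ω₁ h₁) (hanti ω₁ h₁ ω₂ h₂ hle))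

theorem vone_candidatePayoff (h : IsUtility u u' I) (hl : 0 < l) :
    Vone P T u (candidatePayoff I ξ w l) =
      ∫⁻ ω, ENNReal.ofReal (w ω * u (candidatePayoff I ξ w l ω)) ∂P :=
  d.vone_eq h (d.candidatePayoff_aemeasurable h hl)
    (fun _ hω => (d.candidatePayoff_pos h hl hω).le) (d.candidatePayoff_antitone h hl)

/-- A payoff dominated by the candidate payoff earns at least `l` per unit of cost. -/
theorem mul_cost_le_vone (h : IsUtility u u' I) (hl : 0 < l) {Y : Ω → ℝ} (hY : AEMeasurable Y P)
    (hY0 : ∀ ω ∈ G, 0 ≤ Y ω)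
    (hanti : ∀ ω₁ ∈ G, ∀ ω₂ ∈ G, ξ ω₁ ≤ ξ ω₂ → Y ω₂ ≤ Y ω₁)
    (hle : ∀ ω ∈ G, Y ω ≤ candidatePayoff I ξ w l ω) :
    ENNReal.ofReal l * ∫⁻ ω, ENNReal.ofReal (ξ ω * Y ω) ∂P ≤ Vone P T u Y := by
  rw [d.vone_eq h hY hY0 hanti, ← lintegral_const_mul' _ _ ENNReal.ofReal_ne_top]
  refine lintegral_mono_ae ?_
  filter_upwards [d.ae_mem] with ω hω
  rw [← ENNReal.ofReal_mul hl.le]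
  refine ENNReal.ofReal_le_ofReal ?_
  have hw := d.pos ω hω
  rcases (hY0 ω hω).eq_or_lt with h0 | h0
  · rw [← h0, mul_zero, mul_zero, h.map_zero, mul_zero]
  have h1 : l * ξ ω / w ω ≤ u' (Y ω) := by
    by_contra hc
    exact absurd (hle ω hω) (not_le.2 ((h.inverse_lt_iff h0 (d.ratio_pos hl hω)).2 (not_le.1 hc)))
  rw [div_le_iff₀ hw] at h1
  have h2 := h.mul_deriv_le h0
  calc l * (ξ ω * Y ω) = (l * ξ ω) * Y ω := by ring
    _ ≤ (u' (Y ω) * w ω) * Y ω := mul_le_mul_of_nonneg_right h1 h0.le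
    _ = w ω * (Y ω * u' (Y ω)) := by ring
    _ ≤ w ω * u (Y ω) := mul_le_mul_of_nonneg_left h2 hw.le

/-- The candidate payoff maximizes the Choquet objective among payoffs that cost no more. -/
theorem vone_le_of_cost_le (h : IsUtility u u' I) (hl : 0 < l) {X : Ω → ℝ}
    (hX : AEMeasurable X P) (hX0 : ∀ᵐ ω ∂P, 0 ≤ X ω)
    (hcost : ∫⁻ ω, ENNReal.ofReal (ξ ω * X ω) ∂P ≤
      ∫⁻ ω, ENNReal.ofReal (ξ ω * candidatePayoff I ξ w l ω) ∂P)
    (hfin : ∫⁻ ω, ENNReal.ofReal (ξ ω * candidatePayoff I ξ w l ω) ∂P ≠ ⊤) :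
    Vone P T u X ≤ Vone P T u (candidatePayoff I ξ w l) := by
  have hYm := d.candidatePayoff_aemeasurable h hl
  have hY0 : ∀ᵐ ω ∂P, 0 < candidatePayoff I ξ w l ω :=
    d.ae_mem.mono fun ω hω => d.candidatePayoff_pos h hl hω
  have hinj : InjOn u (Ioi 0) := (h.strictMonoOn.mono Ioi_subset_Ici_self).injOn
  have hcont : ContinuousOn u (Ioi 0) :=
    fun x hx => (h.hasDerivAt x hx).continuousAt.continuousWithinAt
  have hord : (u '' Ioi 0).OrdConnected := (isPreconnected_Ioi.image u hcont).ordConnected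
  have hSpos : Ioi (0 : ℝ) ∩ u '' Ioi 0 = u '' Ioi 0 := by
    refine inter_eq_right.2 ?_
    rintro _ ⟨x, hx, rfl⟩
    have := h.strictMonoOn self_mem_Ici (Ioi_subset_Ici_self hx) hx
    rwa [h.map_zero] at this
  have hchange : ∀ Z : Ω → ℝ, (∀ᵐ ω ∂P, 0 ≤ Z ω) →
      ∫⁻ y in u '' Ioi 0, ENNReal.ofReal (T (P {ω | y < u (Z ω)}).toReal) =
        ∫⁻ x in Ioi (0 : ℝ), ENNReal.ofReal (u' x) *
          ENNReal.ofReal (T (P {ω | x < Z ω}).toReal) := by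
    intro Z hZ
    rw [lintegral_image_eq_lintegral_abs_deriv_mul measurableSet_Ioi
      (fun x hx => (h.hasDerivAt x hx).hasDerivWithinAt) hinj]
    refine setLIntegral_congr_fun measurableSet_Ioi fun x hx => ?_
    have hset : {ω | u x < u (Z ω)} =ᵐ[P] {ω | x < Z ω} := by
      filter_upwards [hZ] with ω hω
      exact propext (h.strictMonoOn.lt_iff_lt (Ioi_subset_Ici_self hx) hω)
    simp only [abs_of_pos (h.deriv_pos x hx), measure_congr hset]
  have hanti : ∀ Z : Ω → ℝ,
      Antitone fun x => ∫⁻ ω in {ω | x < Z ω}, ENNReal.ofReal (ξ ω) ∂P :=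
    fun Z x y hxy => lintegral_mono_set fun ω (hω : y < Z ω) => lt_of_le_of_lt hxy hω
  have himage : ∫⁻ y in u '' Ioi 0, ENNReal.ofReal (T (P {ω | y < u (X ω)}).toReal) ≤
      ∫⁻ y in u '' Ioi 0,
        ENNReal.ofReal (T (P {ω | y < u (candidatePayoff I ξ w l ω)}).toReal) := by
    rw [hchange X hX0, hchange _ (hY0.mono fun _ hω => le_of_lt hω)]
    refine ENNReal.le_of_add_le_add_right (ENNReal.mul_ne_top (ENNReal.ofReal_ne_top (r := l)) hfin)
      (le_trans ?_ (add_le_add_right (mul_le_mul_right hcost _) _))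
    rw [← lintegral_setLIntegral_superlevel d.measurable_price.aemeasurable d.price_nonneg_ae hX
        hX0, ← lintegral_setLIntegral_superlevel d.measurable_price.aemeasurable d.price_nonneg_ae
        hYm (hY0.mono fun _ hω => le_of_lt hω),
      ← lintegral_const_mul _ (hanti _).measurable, ← lintegral_const_mul _ (hanti _).measurable,
      ← lintegral_add_right _ ((hanti _).measurable.const_mul _),
      ← lintegral_add_right _ ((hanti _).measurable.const_mul _)]
    exact setLIntegral_mono' measurableSet_Ioi fun x hx => d.lagrangian_le h hl hx _
  have hrest : ∫⁻ y in Ioi (0 : ℝ) \ u '' Ioi 0,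
        ENNReal.ofReal (T (P {ω | y < u (X ω)}).toReal) ≤
      ∫⁻ y in Ioi (0 : ℝ) \ u '' Ioi 0,
        ENNReal.ofReal (T (P {ω | y < u (candidatePayoff I ξ w l ω)}).toReal) := by
    refine setLIntegral_mono' (measurableSet_Ioi.diff hord.measurableSet) fun y hy => ?_
    by_cases hbelow : ∀ x, 0 < x → y < u x
    · have : {ω | y < u (candidatePayoff I ξ w l ω)} =ᵐ[P] univ := by
        filter_upwards [hY0] with ω hω
        exact eq_true (hbelow _ hω)
      rw [measure_congr this]
      exact d.ofReal_map_le _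
    · push Not at hbelow
      obtain ⟨x₀, hx₀, hle⟩ := hbelow
      have hnull : P {ω | y < u (X ω)} = 0 := by
        refine measure_eq_zero_iff_ae_notMem.2 ?_
        filter_upwards [hX0] with ω hω (hlt : y < u (X ω))
        rcases hω.eq_or_lt with h0 | h0
        · rw [← h0, h.map_zero] at hlt
          exact absurd hy.1 (not_lt.2 hlt.le)
        · exact hy.2 (hord.out ⟨x₀, hx₀, rfl⟩ ⟨X ω, h0, rfl⟩ ⟨hle, le_of_lt hlt⟩)
      rw [hnull, ENNReal.toReal_zero, d.ofReal_map_zero]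
      exact zero_le
  have hsplit : ∀ Z : Ω → ℝ, Vone P T u Z =
      (∫⁻ y in u '' Ioi 0, ENNReal.ofReal (T (P {ω | y < u (Z ω)}).toReal)) +
        ∫⁻ y in Ioi (0 : ℝ) \ u '' Ioi 0, ENNReal.ofReal (T (P {ω | y < u (Z ω)}).toReal) := by
    intro Z
    rw [Vone, ← lintegral_inter_add_sdiff _ (Ioi (0 : ℝ)) hord.measurableSet, hSpos]
  rw [hsplit, hsplit]
  exact add_le_add himage hrest

theorem vone_candidatePayoff_lt_top (h : IsUtility u u' I) {m : ℝ} (hm : 0 < m) (hl : 0 < l)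
    (hscale : ∃ k C : ℝ, 0 ≤ k ∧ 0 ≤ C ∧ ∀ y : ℝ, 0 < y → u (I (l * y)) ≤ k * u (I y) + C)
    (hfin : Vone P T u (candidatePayoff I ξ w m) < ⊤) :
    Vone P T u (candidatePayoff I ξ w (l * m)) < ⊤ := by
  obtain ⟨k, C, hk, hC, hle⟩ := hscale
  rw [d.vone_candidatePayoff h hm] at hfin
  rw [d.vone_candidatePayoff h (mul_pos hl hm)]
  calc ∫⁻ ω, ENNReal.ofReal (w ω * u (candidatePayoff I ξ w (l * m) ω)) ∂P
      ≤ ∫⁻ ω, (ENNReal.ofReal k * ENNReal.ofReal (w ω * u (candidatePayoff I ξ w m ω)) +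
          ENNReal.ofReal C * ENNReal.ofReal (w ω)) ∂P := by
        refine lintegral_mono_ae ?_
        filter_upwards [d.ae_mem] with ω hω
        have hw := d.pos ω hω
        have hu := h.nonneg (d.candidatePayoff_pos h hm hω).le
        rw [← ENNReal.ofReal_mul hk, ← ENNReal.ofReal_mul hC,
          ← ENNReal.ofReal_add (mul_nonneg hk (mul_nonneg hw.le hu)) (mul_nonneg hC hw.le)]
        refine ENNReal.ofReal_le_ofReal ?_
        have h1 := hle _ (d.ratio_pos hm hω)
        have h2 : l * (m * ξ ω / w ω) = l * m * ξ ω / w ω := by ring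
        rw [h2] at h1
        have h3 := mul_le_mul_of_nonneg_left h1 hw.le
        simp only [candidatePayoff]
        linarith
    _ = ENNReal.ofReal k * ∫⁻ ω, ENNReal.ofReal (w ω * u (candidatePayoff I ξ w m ω)) ∂P +
          ENNReal.ofReal C * ENNReal.ofReal (T 1) := by
        rw [lintegral_add_right' _ (d.aemeasurable.ennreal_ofReal.const_mul _),
          lintegral_const_mul' _ _ ENNReal.ofReal_ne_top,
          lintegral_const_mul' _ _ ENNReal.ofReal_ne_top, d.lintegral_eq]
    _ < ⊤ := ENNReal.add_lt_top.2 ⟨ENNReal.mul_lt_top ENNReal.ofReal_lt_top hfin,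
        ENNReal.mul_lt_top ENNReal.ofReal_lt_top ENNReal.ofReal_lt_top⟩

theorem integrable_mul_candidatePayoff (h : IsUtility u u' I) (hl : 0 < l)
    (hfin : Vone P T u (candidatePayoff I ξ w l) < ⊤) :
    Integrable (fun ω => ξ ω * candidatePayoff I ξ w l ω) P := by
  have hm := d.candidatePayoff_aemeasurable h hl
  refine ⟨(d.measurable_price.aemeasurable.mul hm).aestronglyMeasurable, ?_⟩
  rw [hasFiniteIntegral_iff_ofReal (d.ae_mem.mono fun ω hω =>
    mul_nonneg (d.price_pos ω hω).le (d.candidatePayoff_pos h hl hω).le)]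
  have hle := d.mul_cost_le_vone h hl hm (fun _ hω => (d.candidatePayoff_pos h hl hω).le)
    (d.candidatePayoff_antitone h hl) fun _ _ => le_rfl
  exact ENNReal.lt_top_of_mul_ne_top_right (hle.trans_lt hfin).ne (ENNReal.ofReal_pos.2 hl).ne'

/-- If every candidate payoff has finite cost, then every budget is the cost of some candidate
payoff. -/
theorem exists_cost_eq (h : IsUtility u u' I)
    (hintegrable : ∀ l : ℝ, 0 < l → Integrable (fun ω => ξ ω * candidatePayoff I ξ w l ω) P)
    {a : ℝ} (ha : 0 < a) :
    ∃ l : ℝ, 0 < l ∧ ∫ ω, ξ ω * candidatePayoff I ξ w l ω ∂P = a := by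
  have hle : ∀ l₁ l₂ : ℝ, 0 < l₁ → l₁ ≤ l₂ → ∀ᵐ ω ∂P,
      ‖ξ ω * candidatePayoff I ξ w l₂ ω‖ ≤ ξ ω * candidatePayoff I ξ w l₁ ω := by
    intro l₁ l₂ h₁ h₁₂
    filter_upwards [d.ae_mem] with ω hω
    have h₂ := h₁.trans_le h₁₂
    have hξ := d.price_pos ω hω
    rw [Real.norm_of_nonneg (mul_pos hξ (d.candidatePayoff_pos h h₂ hω)).le]
    refine mul_le_mul_of_nonneg_left
      (h.inverse_antitoneOn (d.ratio_pos h₁ hω) (d.ratio_pos h₂ hω) ?_) hξ.le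
    exact div_le_div_of_nonneg_right (mul_le_mul_of_nonneg_right h₁₂ hξ.le) (d.pos ω hω).le
  have hcont : ContinuousOn (fun l => ∫ ω, ξ ω * candidatePayoff I ξ w l ω ∂P) (Ioi 0) := by
    intro l (hl : 0 < l)
    refine (continuousAt_of_dominated
      (bound := fun ω => ξ ω * candidatePayoff I ξ w (l / 2) ω) ?_ ?_
      (hintegrable _ (half_pos hl)) ?_).continuousWithinAt
    · filter_upwards [lt_mem_nhds hl] with x hx
      exact (hintegrable x hx).aestronglyMeasurable
    · filter_upwards [lt_mem_nhds (half_lt_self hl)] with x hx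
      exact hle _ _ (half_pos hl) hx.le
    · filter_upwards [d.ae_mem] with ω hω
      have hI : ContinuousAt I (l * ξ ω / w ω) :=
        h.inverse_continuousOn.continuousAt (Ioi_mem_nhds (d.ratio_pos hl hω))
      exact continuousAt_const.mul
        (ContinuousAt.comp (f := fun x : ℝ => x * ξ ω / w ω) hI (by fun_prop))
  obtain ⟨l₁, hl₁, hc₁⟩ : ∃ l : ℝ, 0 < l ∧ ∫ ω, ξ ω * candidatePayoff I ξ w l ω ∂P ≤ a := by
    have hlim : Tendsto (fun n : ℕ => ∫ ω, ξ ω * candidatePayoff I ξ w ((n : ℝ) + 1) ω ∂P) atTop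
        (nhds (∫ _, (0 : ℝ) ∂P)) := by
      refine tendsto_integral_of_dominated_convergence
        (fun ω => ξ ω * candidatePayoff I ξ w 1 ω)
        (fun n => (hintegrable _ (by positivity)).aestronglyMeasurable) (hintegrable 1 one_pos)
        (fun n => hle _ _ one_pos (by simp)) ?_
      filter_upwards [d.ae_mem] with ω hω
      rw [← mul_zero (ξ ω)]
      refine Tendsto.const_mul _ (h.tendsto_inverse_atTop.comp ?_)
      exact ((tendsto_atTop_add_const_right _ 1 tendsto_natCast_atTop_atTop).atTop_mul_const
        (d.price_pos ω hω)).atTop_div_const (d.pos ω hω)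
    rw [integral_zero] at hlim
    obtain ⟨n, hn⟩ := (hlim.eventually (gt_mem_nhds ha)).exists
    exact ⟨_, by positivity, hn.le⟩
  obtain ⟨l₂, hl₂, hc₂⟩ : ∃ l : ℝ, 0 < l ∧ a ≤ ∫ ω, ξ ω * candidatePayoff I ξ w l ω ∂P := by
    have hpos : ∀ n : ℕ, (0 : ℝ) < 1 / ((n : ℝ) + 1) := fun n => Nat.one_div_pos_of_nat
    have hfatou := lintegral_liminf_le' (μ := P) (u := atTop)
      (f := fun (n : ℕ) ω => ENNReal.ofReal (ξ ω * candidatePayoff I ξ w (1 / ((n : ℝ) + 1)) ω))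
      fun n => (hintegrable _ (hpos n)).aestronglyMeasurable.aemeasurable.ennreal_ofReal
    have htop : ∀ᵐ ω ∂P, liminf (fun n : ℕ =>
        ENNReal.ofReal (ξ ω * candidatePayoff I ξ w (1 / ((n : ℝ) + 1)) ω)) atTop = ⊤ := by
      filter_upwards [d.ae_mem] with ω hω
      refine Tendsto.liminf_eq (ENNReal.tendsto_ofReal_nhds_top.2 ?_)
      refine Tendsto.const_mul_atTop (d.price_pos ω hω) (h.tendsto_inverse_zero.comp ?_)
      refine tendsto_nhdsWithin_iff.2 ⟨?_, Eventually.of_forall fun n => d.ratio_pos (hpos n) hω⟩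
      have := (tendsto_one_div_add_atTop_nhds_zero_nat (𝕜 := ℝ)).mul_const (ξ ω / w ω)
      rw [zero_mul] at this
      exact this.congr fun n => by ring
    rw [lintegral_congr_ae htop, lintegral_const, measure_univ, mul_one] at hfatou
    obtain ⟨n, hn⟩ := (eventually_lt_of_lt_liminf
      ((ENNReal.ofReal_lt_top (r := a)).trans_le hfatou)).exists
    refine ⟨_, hpos n, ?_⟩
    rw [← ofReal_integral_eq_lintegral_ofReal (hintegrable _ (hpos n)) (d.ae_mem.mono fun ω hω =>
      mul_nonneg (d.price_pos ω hω).le (d.candidatePayoff_pos h (hpos n) hω).le)] at hn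
    exact (ENNReal.ofReal_lt_ofReal_iff'.1 hn).1.le
  obtain ⟨l, hl, hla⟩ := isPreconnected_Ioi.intermediate_value hl₁ hl₂ hcont ⟨hc₁, hc₂⟩
  exact ⟨l, hl, hla⟩

/-- Scaling a payoff by `t` scales its Choquet objective by at least `min t 1`. -/
theorem mul_vone_le_vone_mul (h : IsUtility u u' I) {Y : Ω → ℝ} (hY : AEMeasurable Y P)
    (hY0 : ∀ ω ∈ G, 0 ≤ Y ω)
    (hanti : ∀ ω₁ ∈ G, ∀ ω₂ ∈ G, ξ ω₁ ≤ ξ ω₂ → Y ω₂ ≤ Y ω₁) {t : ℝ} (ht : 0 ≤ t) :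
    ENNReal.ofReal (min t 1) * Vone P T u Y ≤ Vone P T u fun ω => t * Y ω := by
  have hmin : 0 ≤ min t 1 := le_min ht zero_le_one
  rw [d.vone_eq h hY hY0 hanti, d.vone_eq h (hY.const_mul t) (fun ω hω => mul_nonneg ht (hY0 ω hω))
    (fun ω₁ h₁ ω₂ h₂ hle => mul_le_mul_of_nonneg_left (hanti ω₁ h₁ ω₂ h₂ hle) ht),
    ← lintegral_const_mul' _ _ ENNReal.ofReal_ne_top]
  refine lintegral_mono_ae ?_
  filter_upwards [d.ae_mem] with ω hω
  rw [← ENNReal.ofReal_mul hmin, mul_left_comm]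
  refine ENNReal.ofReal_le_ofReal (mul_le_mul_of_nonneg_left ?_ (d.pos ω hω).le)
  refine (h.mul_le_map_mul hmin (min_le_right _ _) (hY0 ω hω)).trans ?_
  exact h.strictMonoOn.monotoneOn (mem_Ici.2 (mul_nonneg hmin (hY0 ω hω)))
    (mem_Ici.2 (mul_nonneg ht (hY0 ω hω)))
    (mul_le_mul_of_nonneg_right (min_le_left _ _) (hY0 ω hω))

/-- A candidate payoff of infinite value can be truncated and rescaled to a payoff of cost `a` and
value at least `l * a`. -/
theorem exists_feasible_mul_le_vone (h : IsUtility u u' I) (hl : 0 < l)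
    (htop : Vone P T u (candidatePayoff I ξ w l) = ⊤) {a : ℝ} (ha : 0 < a) :
    ∃ X : Ω → ℝ, FeasQ P ξ a X ∧ ENNReal.ofReal (l * a) ≤ Vone P T u X := by
  let Y : ℕ → Ω → ℝ := fun n => {ω | ξ ω ≤ n}.indicator fun ω => min (candidatePayoff I ξ w l ω) n
  have hYm : ∀ n, AEMeasurable (Y n) P := fun n =>
    ((d.candidatePayoff_aemeasurable h hl).min aemeasurable_const).indicator
      (measurableSet_le d.measurable_price measurable_const)
  have hY_of_le : ∀ n : ℕ, ∀ ω, ξ ω ≤ n → Y n ω = min (candidatePayoff I ξ w l ω) n :=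
    fun n ω hω => indicator_of_mem (s := {ω | ξ ω ≤ n}) hω _
  have hY_of_lt : ∀ n : ℕ, ∀ ω, (n : ℝ) < ξ ω → Y n ω = 0 :=
    fun n ω hω => indicator_of_notMem (s := {ω | ξ ω ≤ n}) (not_le.2 hω) _
  have hmin0 : ∀ n : ℕ, ∀ ω ∈ G, 0 ≤ min (candidatePayoff I ξ w l ω) n :=
    fun n ω hω => le_min (d.candidatePayoff_pos h hl hω).le n.cast_nonneg
  have hY0 : ∀ n, ∀ ω ∈ G, 0 ≤ Y n ω := fun n ω hω => by
    rcases le_or_gt (ξ ω) n with hn | hn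
    · rw [hY_of_le n ω hn]
      exact hmin0 n ω hω
    · rw [hY_of_lt n ω hn]
  have hYle : ∀ n, ∀ ω ∈ G, Y n ω ≤ candidatePayoff I ξ w l ω := fun n ω hω => by
    rcases le_or_gt (ξ ω) n with hn | hn
    · rw [hY_of_le n ω hn]
      exact min_le_left _ _
    · rw [hY_of_lt n ω hn]
      exact (d.candidatePayoff_pos h hl hω).le
  have hYanti : ∀ n, ∀ ω₁ ∈ G, ∀ ω₂ ∈ G, ξ ω₁ ≤ ξ ω₂ → Y n ω₂ ≤ Y n ω₁ := by
    intro n ω₁ h₁ ω₂ h₂ hle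
    rcases le_or_gt (ξ ω₂) n with hn | hn
    · rw [hY_of_le n ω₂ hn, hY_of_le n ω₁ (hle.trans hn)]
      exact min_le_min_right _ (d.candidatePayoff_antitone h hl ω₁ h₁ ω₂ h₂ hle)
    · rw [hY_of_lt n ω₂ hn]
      exact hY0 n ω₁ h₁
  have hYint : ∀ n, Integrable (fun ω => ξ ω * Y n ω) P := fun n => by
    refine Integrable.of_bound
      (d.measurable_price.aemeasurable.mul (hYm n)).aestronglyMeasurable ((n : ℝ) * n) ?_
    filter_upwards [d.ae_mem] with ω hω
    have hξ := d.price_pos ω hω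
    rw [Real.norm_of_nonneg (mul_nonneg hξ.le (hY0 n ω hω))]
    rcases le_or_gt (ξ ω) n with hn | hn
    · rw [hY_of_le n ω hn]
      exact mul_le_mul hn (min_le_right _ _) (hmin0 n ω hω) n.cast_nonneg
    · rw [hY_of_lt n ω hn, mul_zero]
      positivity
  obtain ⟨n, hn⟩ : ∃ n, ENNReal.ofReal (l * a) < Vone P T u (Y n) := by
    have hfatou := lintegral_liminf_le' (μ := P) (u := atTop)
      (f := fun (n : ℕ) ω => ENNReal.ofReal (w ω * u (Y n ω)))
      fun n => (d.aemeasurable.mul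
        (h.aemeasurable_comp (hYm n) (d.ae_mem.mono (hY0 n)))).ennreal_ofReal
    have hlim : ∀ᵐ ω ∂P, liminf (fun n : ℕ => ENNReal.ofReal (w ω * u (Y n ω))) atTop =
        ENNReal.ofReal (w ω * u (candidatePayoff I ξ w l ω)) := by
      refine ae_of_all _ fun ω => Tendsto.liminf_eq (tendsto_const_nhds.congr' ?_)
      filter_upwards [tendsto_natCast_atTop_atTop.eventually_ge_atTop (ξ ω),
        tendsto_natCast_atTop_atTop.eventually_ge_atTop (candidatePayoff I ξ w l ω)] with n h₁ h₂
      rw [hY_of_le n ω h₁, min_eq_left h₂]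
    rw [lintegral_congr_ae hlim, ← d.vone_candidatePayoff h hl, htop] at hfatou
    obtain ⟨n, hn⟩ := (eventually_lt_of_lt_liminf
      ((ENNReal.ofReal_lt_top (r := l * a)).trans_le hfatou)).exists
    refine ⟨n, ?_⟩
    rwa [d.vone_eq h (hYm n) (hY0 n) (hYanti n)]
  have hξY : 0 ≤ᵐ[P] fun ω => ξ ω * Y n ω :=
    d.ae_mem.mono fun ω hω => mul_nonneg (d.price_pos ω hω).le (hY0 n ω hω)
  have hcpos : 0 < ∫ ω, ξ ω * Y n ω ∂P := by
    refine (integral_nonneg_of_ae hξY).lt_of_ne' fun h0 => ?_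
    rw [integral_eq_zero_iff_of_nonneg_ae hξY (hYint n)] at h0
    have hzero : Vone P T u (Y n) = 0 := by
      rw [d.vone_eq h (hYm n) (hY0 n) (hYanti n), ← lintegral_zero (μ := P)]
      refine lintegral_congr_ae ?_
      filter_upwards [h0, d.ae_mem] with ω hω hG
      have : Y n ω = 0 := (mul_eq_zero.1 hω).resolve_left (d.price_pos ω hG).ne'
      rw [this, h.map_zero, mul_zero, ENNReal.ofReal_zero]
    rw [hzero] at hn
    exact not_lt_zero hn
  have hcost := d.mul_cost_le_vone h hl (hYm n) (hY0 n) (hYanti n) (hYle n)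
  rw [← ofReal_integral_eq_lintegral_ofReal (hYint n) hξY, ← ENNReal.ofReal_mul hl.le] at hcost
  generalize hc : ∫ ω, ξ ω * Y n ω ∂P = c at hcpos hcost
  have ht : 0 < a / c := div_pos ha hcpos
  have hcomm : (fun ω => ξ ω * (a / c * Y n ω)) = fun ω => a / c * (ξ ω * Y n ω) :=
    funext fun ω => mul_left_comm _ _ _
  refine ⟨fun ω => a / c * Y n ω, ⟨(hYm n).const_mul _,
    d.ae_mem.mono fun ω hω => mul_nonneg ht.le (hY0 n ω hω), ?_, ?_⟩, ?_⟩
  · rw [hcomm]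
    exact (hYint n).const_mul _
  · rw [hcomm, integral_const_mul, hc, div_mul_cancel₀ _ hcpos.ne']
  · refine le_trans ?_ (d.mul_vone_le_vone_mul h (hYm n) (hY0 n) (hYanti n) ht.le)
    rcases le_total (a / c) 1 with h1 | h1
    · rw [min_eq_left h1]
      refine le_trans (le_of_eq ?_) (mul_le_mul_right hcost _)
      rw [← ENNReal.ofReal_mul ht.le]
      congr 1
      field_simp
    · rw [min_eq_right h1, ENNReal.ofReal_one, one_mul]
      exact hn.le

end IsDistortionDensity

end Payoff

/-- Theorem C.2: under Assumption (Fdec), with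
`X(λ) = (u')⁻¹(λξ/T'(F_ξ(ξ)))` (where `I = (u')⁻¹`): if `V₁(X(1)) < ∞`
then some `X(λ)`, `λ > 0`, matching the budget `a` is optimal for (Q);
if `V₁(X(1)) = ∞` then Problem (Q) is ill-posed. -/
theorem choquet_maximization
    {Ω : Type*} [MeasurableSpace Ω] (P : MeasureTheory.Measure Ω)
    [MeasureTheory.IsProbabilityMeasure P]
    (ξ : Ω → ℝ) (hξ : Measurable ξ) (hξpos : ∀ᵐ ω ∂P, 0 < ξ ω)
    (hatomless : ∀ b : ℝ, P {ω | ξ ω = b} = 0)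
    (F : ℝ → ℝ) (hF : ∀ x : ℝ, F x = (P {ω | ξ ω ≤ x}).toReal)
    (T T' : ℝ → ℝ)
    (hTmono : StrictMonoOn T (Set.Icc 0 1))
    (hT' : ∀ x ∈ Set.Icc (0:ℝ) 1, HasDerivWithinAt T (T' x) (Set.Icc 0 1) x)
    (hT0 : T 0 = 0) (hT1 : T 1 = 1)
    (u u' u'' : ℝ → ℝ)
    (humono : StrictMonoOn u (Set.Ici 0))
    (huconc : StrictConcaveOn ℝ (Set.Ici 0) u)
    (hu0 : u 0 = 0)
    (hu' : ∀ x ∈ Set.Ioi (0:ℝ), HasDerivAt u (u' x) x)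
    (hu'' : ∀ x ∈ Set.Ioi (0:ℝ), HasDerivAt u' (u'' x) x)
    (hu'0 : Filter.Tendsto u' (nhdsWithin 0 (Set.Ioi 0)) Filter.atTop)
    (hu'inf : Filter.Tendsto u' Filter.atTop (nhds 0))
    -- `I = (u')⁻¹`
    (I : ℝ → ℝ) (hI : ∀ y : ℝ, 0 < y → 0 < I y ∧ u' (I y) = y)
    -- `F_ξ⁻¹(z)/T'(z)` is nondecreasing in `z ∈ (0,1]`
    (hFdec : ∀ z₁ z₂ : ℝ, 0 < z₁ → z₁ ≤ z₂ → z₂ ≤ 1 →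
      sInf {c : EReal | ∃ y : ℝ, 0 ≤ y ∧ z₁ ≤ F y ∧ c = (y : EReal)} * ((T' z₂ : ℝ) : EReal) ≤
        sInf {c : EReal | ∃ y : ℝ, 0 ≤ y ∧ z₂ ≤ F y ∧ c = (y : EReal)} * ((T' z₁ : ℝ) : EReal))
    -- `liminf_{x→∞} (−x u''(x)/u'(x)) > 0`
    (hliminf : 0 < Filter.liminf (fun x : ℝ => -x * u'' x / u' x) Filter.atTop)
    (a : ℝ) (ha : 0 < a) :
    -- first alternative
    (Vone P T u (fun ω => I (ξ ω / T' (F (ξ ω)))) < ⊤ →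
      ∃ l : ℝ, 0 < l ∧
        FeasQ P ξ a (fun ω => I (l * ξ ω / T' (F (ξ ω)))) ∧
        ∀ X : Ω → ℝ, FeasQ P ξ a X →
          Vone P T u X ≤ Vone P T u (fun ω => I (l * ξ ω / T' (F (ξ ω))))) ∧
    -- second alternative
    (Vone P T u (fun ω => I (ξ ω / T' (F (ξ ω)))) = ⊤ →
      sSup {v : ℝ≥0∞ | ∃ X : Ω → ℝ, FeasQ P ξ a X ∧ v = Vone P T u X} = ⊤) := by
  have d := isDistortionDensity_deriv hξ hξpos hatomless hF hTmono hT' hT0 hFdec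
  have h := IsUtility.of_strictConcaveOn humono huconc hu0 hu' hI
  have hone : (fun ω => I (ξ ω / T' (F (ξ ω)))) =
      candidatePayoff I ξ (fun ω => T' (F (ξ ω))) 1 := by
    funext ω
    rw [candidatePayoff, one_mul]
  rw [hone]
  constructor
  · intro hfin
    have hintegrable : ∀ l : ℝ, 0 < l →
        Integrable (fun ω => ξ ω * candidatePayoff I ξ (fun ω => T' (F (ξ ω))) l ω) P :=
      fun l hl => by
        have := d.vone_candidatePayoff_lt_top h one_pos hl
          (h.exists_map_inverse_mul_le hu'' hliminf hl) hfin
        rw [mul_one] at this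
        exact d.integrable_mul_candidatePayoff h hl this
    obtain ⟨l, hl, hcost⟩ := d.exists_cost_eq h hintegrable ha
    have hY0 : ∀ᵐ ω ∂P, 0 ≤ candidatePayoff I ξ (fun ω => T' (F (ξ ω))) l ω :=
      d.ae_mem.mono fun ω hω => (d.candidatePayoff_pos h hl hω).le
    have hlint : ∀ X : Ω → ℝ, FeasQ P ξ a X →
        ∫⁻ ω, ENNReal.ofReal (ξ ω * X ω) ∂P = ENNReal.ofReal a := by
      rintro X ⟨-, hX0, hXint, hXa⟩
      rw [← hXa, ofReal_integral_eq_lintegral_ofReal hXint]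
      filter_upwards [hX0, hξpos] with ω h1 h2
      exact mul_nonneg h2.le h1
    have hfeas : FeasQ P ξ a (candidatePayoff I ξ (fun ω => T' (F (ξ ω))) l) :=
      ⟨d.candidatePayoff_aemeasurable h hl, hY0, hintegrable l hl, hcost⟩
    refine ⟨l, hl, hfeas, fun X hX => ?_⟩
    refine d.vone_le_of_cost_le h hl hX.1 hX.2.1 ?_ ?_
    · rw [hlint X hX, hlint _ hfeas]
    · rw [hlint _ hfeas]
      exact ENNReal.ofReal_ne_top
  · intro htop
    refine eq_top_iff.2 (ENNReal.le_of_forall_nnreal_lt fun r _ => ?_)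
    have hl : 0 < ((r : ℝ) + 1) / a := div_pos (by positivity) ha
    have htop_l : Vone P T u
        (candidatePayoff I ξ (fun ω => T' (F (ξ ω))) (((r : ℝ) + 1) / a)) = ⊤ := by
      by_contra hne
      have := d.vone_candidatePayoff_lt_top h hl (inv_pos.2 hl)
        (h.exists_map_inverse_mul_le hu'' hliminf (inv_pos.2 hl)) (lt_top_iff_ne_top.2 hne)
      rw [inv_mul_cancel₀ hl.ne'] at this
      exact this.ne htop
    obtain ⟨X, hX, hle⟩ := d.exists_feasible_mul_le_vone h hl htop_l ha
    refine le_trans ?_ (le_sSup ⟨X, hX, rfl⟩)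
    refine le_trans ?_ hle
    rw [div_mul_cancel₀ _ ha.ne', ← ENNReal.ofReal_coe_nnreal]
    exact ENNReal.ofReal_le_ofReal (by linarith)

end
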